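/- arXiv:0806.3046 — 2 statements merged into one kernel-verified Lean document; each statement's English description precedes it below -/
import Mathlib

section
/- Fix positive integers n and k with d = n div k and r = n mod k, and let P be the Dyck path with d blocks of k north steps followed by k east steps and a final block of r north and r east steps. Then Σ_g q^{area(g)}, summed over Dyck paths g of length n lying weakly below P, equals (Σ_{h ∈ DS_k} q^{area(h)})^d · (Σ_{h ∈ DS_r} q^{area(h)}), where DS_m is the set of Dyck sequences of length m. -/
/-- A Dyck sequence of length `n`: `g 0 = 0` and `g (i+1) ≤ g i + 1`. -/
def IsDyckSeq {n : ℕ} (g : Fin n → ℕ) : Prop :=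
  (∀ i : Fin n, (i : ℕ) = 0 → g i = 0) ∧
  (∀ i j : Fin n, (j : ℕ) = (i : ℕ) + 1 → g j ≤ g i + 1)

/-- The area statistic of a Dyck sequence. -/
def area {n : ℕ} (g : Fin n → ℕ) : ℕ := ∑ i, g i

/-- The dinv statistic: pairs `i < j` with `g i - g j ∈ {0, 1}`. -/
def dinv {n : ℕ} (g : Fin n → ℕ) : ℕ :=
  (Finset.univ.filter (fun p : Fin n × Fin n =>
    p.1 < p.2 ∧ (g p.1 = g p.2 ∨ g p.1 = g p.2 + 1))).card

theorem IsDyckSeq.le_index {n : ℕ} {g : Fin n → ℕ} (hg : IsDyckSeq g) (i : Fin n) :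
    g i ≤ i := by
  obtain ⟨i, hi⟩ := i
  induction i with
  | zero => exact (hg.1 ⟨0, hi⟩ rfl).le
  | succ i ih =>
    exact (hg.2 ⟨i, by omega⟩ ⟨i + 1, hi⟩ rfl).trans (Nat.succ_le_succ (ih (by omega)))

/-- The Dyck sequences of length `n` lying below the staircase `i ↦ i % k`. -/
def belowStaircase (k n : ℕ) : Set (Fin n → ℕ) :=
  {g | IsDyckSeq g ∧ ∀ i : Fin n, g i ≤ (i : ℕ) % k}

theorem finite_belowStaircase (k n : ℕ) : (belowStaircase k n).Finite :=
  (Set.finite_Iic fun i : Fin n => (i : ℕ) % k).subset fun _ hg => hg.2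

theorem belowStaircase_eq_of_le {k n : ℕ} (h : n ≤ k) :
    belowStaircase k n = {g | IsDyckSeq g} := by
  ext g
  refine ⟨fun hg => hg.1, fun hg => ⟨hg, fun i => ?_⟩⟩
  rw [Nat.mod_eq_of_lt (i.isLt.trans_le h)]
  exact hg.le_index i

theorem area_append {m n : ℕ} (a : Fin m → ℕ) (b : Fin n → ℕ) :
    area (Fin.append a b) = area a + area b := by
  simp [area, Fin.sum_univ_add]

theorem append_mem_belowStaircase {k n : ℕ} {a : Fin k → ℕ} {b : Fin n → ℕ} :
    Fin.append a b ∈ belowStaircase k (k + n) ↔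
      a ∈ belowStaircase k k ∧ b ∈ belowStaircase k n := by
  constructor
  · rintro ⟨⟨h0, h1⟩, h2⟩
    refine ⟨⟨⟨fun i hi => ?_, fun i j hij => ?_⟩, fun i => ?_⟩,
      ⟨⟨fun i hi => ?_, fun i j hij => ?_⟩, fun i => ?_⟩⟩
    · simpa using h0 (Fin.castAdd n i) (by simpa using hi)
    · simpa using h1 (Fin.castAdd n i) (Fin.castAdd n j) (by simpa using hij)
    · simpa using h2 (Fin.castAdd n i)
    · simpa [hi] using h2 (Fin.natAdd k i)
    · simpa using h1 (Fin.natAdd k i) (Fin.natAdd k j) (by simp; omega)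
    · simpa using h2 (Fin.natAdd k i)
  · rintro ⟨⟨⟨a0, a1⟩, a2⟩, ⟨⟨b0, b1⟩, b2⟩⟩
    have below : ∀ i, Fin.append a b i ≤ (i : ℕ) % k := fun i => by
      induction i using Fin.addCases with
      | left i => simpa using a2 i
      | right i => simpa using b2 i
    refine ⟨⟨fun i hi => ?_, fun i j hij => ?_⟩, below⟩
    · simpa [hi] using below i
    · induction i using Fin.addCases with
      | left i =>
        induction j using Fin.addCases with
        | left j => simpa using a1 i j (by simpa using hij)
        | right j =>
          have hj : (j : ℕ) = 0 := by
            simp only [Fin.val_natAdd, Fin.val_castAdd] at hij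
            omega
          simp [b0 j hj]
      | right i =>
        induction j using Fin.addCases with
        | left j =>
          simp only [Fin.val_natAdd, Fin.val_castAdd] at hij
          omega
        | right j =>
          simp only [Fin.val_natAdd] at hij
          simpa using b1 i j (by omega)

/-- The area generating polynomial of the Dyck sequences below the staircase `i ↦ i % k`. -/
noncomputable def staircaseAreaGen (k n : ℕ) : Polynomial ℤ :=
  ∑ᶠ g ∈ belowStaircase k n, (Polynomial.X : Polynomial ℤ) ^ area g

theorem staircaseAreaGen_add (k n : ℕ) :
    staircaseAreaGen k (k + n) = staircaseAreaGen k k * staircaseAreaGen k n := by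
  unfold staircaseAreaGen
  simp only [finsum_mem_eq_finite_toFinset_sum _ (finite_belowStaircase _ _)]
  rw [Finset.sum_mul_sum, ← Finset.sum_product']
  refine (Finset.sum_equiv (Fin.appendEquiv k n) (fun p => ?_) fun p _ => ?_).symm
  · simp [Fin.appendEquiv, append_mem_belowStaircase]
  · simp [Fin.appendEquiv, area_append, pow_add]

theorem staircaseAreaGen_mul_add (k d r : ℕ) :
    staircaseAreaGen k (k * d + r) = staircaseAreaGen k k ^ d * staircaseAreaGen k r := by
  induction d with
  | zero => simp
  | succ d ih =>
    rw [show k * (d + 1) + r = k + (k * d + r) by ring, staircaseAreaGen_add, ih, pow_succ']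
    ring

/-- The area generating polynomial of Dyck paths of length `n` lying weakly below
the staircase path `P` (with `n div k` blocks of size `k` and a final block of
size `n mod k`; its Dyck sequence is `i ↦ i % k`) factors as the `(n div k)`-th
power of the area generating polynomial of `DS_k` times that of `DS_(n mod k)`. -/
theorem area_gen_below_staircase (n k : ℕ) (hn : 0 < n) (hk : 0 < k) :
    (∑ᶠ g ∈ {g : Fin n → ℕ | IsDyckSeq g ∧ ∀ i : Fin n, g i ≤ (i : ℕ) % k},
        (Polynomial.X : Polynomial ℤ) ^ area g) =
      (∑ᶠ h ∈ {h : Fin k → ℕ | IsDyckSeq h},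
          (Polynomial.X : Polynomial ℤ) ^ area h) ^ (n / k) *
        ∑ᶠ h ∈ {h : Fin (n % k) → ℕ | IsDyckSeq h},
          (Polynomial.X : Polynomial ℤ) ^ area h := by
  rw [← belowStaircase_eq_of_le le_rfl, ← belowStaircase_eq_of_le (Nat.mod_lt n hk).le]
  have h := staircaseAreaGen_mul_add k (n / k) (n % k)
  rwa [Nat.div_add_mod] at h
end

section
/- For positive integers n and k with k > n/2, the k-Schur function indexed by a column satisfies s_{1^n}^{(k)}(X;t) = Σ_{j=0}^{n-k} t^j s_{(2^j, 1^{n-2j})}(X), i.e., it expands as s_{1^n} + t s_{2,1^{n-2}} + ... + t^{n-k} s_{2^{n-k},1^{2k-n}}. -/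
open MvPolynomial

/-- The ring of symmetric functions over `R`, presented as the polynomial ring
`R[h₁, h₂, ...]` in the complete homogeneous symmetric functions. -/
abbrev SymFn (R : Type*) [CommRing R] := MvPolynomial {n : ℕ // 0 < n} R

variable {R : Type*} [CommRing R]

/-- The complete homogeneous symmetric function `h_a`, extended by `h_0 = 1` and
`h_a = 0` for `a < 0`. -/
noncomputable def hInt (a : ℤ) : SymFn R :=
  if h : 0 < a then X ⟨a.toNat, by omega⟩ else if a = 0 then 1 else 0

/-- The complete homogeneous symmetric function `h_n`. -/
noncomputable def hSym (n : ℕ) : SymFn R := hInt (n : ℤ)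

/-- `h_λ` for a partition `λ` given as a list of parts. -/
noncomputable def hOf (l : List ℕ) : SymFn R := (l.map hSym).prod

/-- The Schur function of an arbitrary integer vector `a`, defined by the
Jacobi–Trudi determinant `det [h_{a_i - i + j}]`. -/
noncomputable def schurInt {ℓ : ℕ} (a : Fin ℓ → ℤ) : SymFn R :=
  (Matrix.of fun i j : Fin ℓ => (hInt (a i - (i : ℕ) + (j : ℕ)) : SymFn R)).det

/-- The Schur function `s_λ` of a partition `λ` given as a list of parts. -/
noncomputable def schurOf (l : List ℕ) : SymFn R :=
  schurInt fun i : Fin l.length => (l.get i : ℤ)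

/-- The elementary symmetric function `e_n = s_{1^n}`, via Jacobi–Trudi; it
satisfies the defining recurrence `Σ_{i+j=n} (-1)^i h_i e_j = 0`. -/
noncomputable def eSym (n : ℕ) : SymFn R :=
  schurOf (List.replicate n 1)

/-- `e_λ` for a partition `λ` given as a list of parts. -/
noncomputable def eOf (l : List ℕ) : SymFn R := (l.map eSym).prod

/-- The fundamental involution `ω`, the algebra endomorphism with `ω h_n = e_n`
(hence `ω h_λ = e_λ`). -/
noncomputable def omegaSym : SymFn R →ₐ[R] SymFn R :=
  aeval fun p : {n : ℕ // 0 < n} => eSym p.1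

/-- The modified Hall–Littlewood symmetric function `Q'_λ(X;t)`, with
coefficients in `ℤ[t]`, defined by the classical raising-operator formula
`Q'_λ = ∏_{i<j} (1 - t R_{ij})^{-1} s_λ
      = Σ_m t^{|m|} s_{λ + Σ_{i<j} m_{ij} (ε_i - ε_j)}`,
the (finitely supported) sum ranging over families `m` of nonnegative integers
indexed by the pairs `i < j`. -/
noncomputable def QpHL (l : List ℕ) : SymFn (Polynomial ℤ) :=
  ∑ᶠ m : {p : Fin l.length × Fin l.length // p.1 < p.2} → ℕ,
    C (Polynomial.X ^ (∑ p : {p : Fin l.length × Fin l.length // p.1 < p.2}, m p)) *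
      schurInt (fun i : Fin l.length =>
        (l.get i : ℤ) + ∑ p : {p : Fin l.length × Fin l.length // p.1 < p.2},
          (m p : ℤ) * ((if p.1.1 = i then 1 else 0) - (if p.1.2 = i then 1 else 0)))

/-- Substitution `t ↦ 1/t`, from `ℤ[t]` into Laurent polynomials `ℤ[t,t⁻¹]`. -/
noncomputable def tInv : Polynomial ℤ →+* LaurentPolynomial ℤ :=
  (LaurentPolynomial.invert (R := ℤ)).toAlgHom.toRingHom.comp Polynomial.toLaurent

namespace PowerSeries

variable {A : Type*} [CommRing A]

/-- The coefficient of a power series at an integer exponent, zero at negative exponents. -/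
noncomputable def coeffInt (f : PowerSeries A) (z : ℤ) : A :=
  if 0 ≤ z then coeff z.toNat f else 0

theorem coeffInt_natCast (f : PowerSeries A) (n : ℕ) : coeffInt f (n : ℤ) = coeff n f := by
  simp [coeffInt]

theorem coeffInt_of_neg (f : PowerSeries A) {z : ℤ} (hz : z < 0) : coeffInt f z = 0 :=
  if_neg (not_le.mpr hz)

theorem sum_coeffInt_mul (f g : PowerSeries A) {N a b : ℕ} (hb : b < N) :
    ∑ c ∈ Finset.range N, coeffInt f ((c : ℤ) - a) * coeffInt g ((b : ℤ) - c) =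
      coeffInt (f * g) ((b : ℤ) - a) := by
  have hsub : ∑ c ∈ Finset.range N, coeffInt f ((c : ℤ) - a) * coeffInt g ((b : ℤ) - c) =
      ∑ c ∈ Finset.Ico a (b + 1), coeffInt f ((c : ℤ) - a) * coeffInt g ((b : ℤ) - c) := by
    refine (Finset.sum_subset (fun c hc => ?_) fun c _ hc => ?_).symm
    · simp only [Finset.mem_Ico, Finset.mem_range] at hc ⊢
      omega
    · rcases lt_or_ge c a with h | h
      · rw [coeffInt_of_neg f (by omega), zero_mul]
      · rw [coeffInt_of_neg g (by simp only [Finset.mem_Ico] at hc; omega), mul_zero]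
  rw [hsub]
  rcases lt_or_ge b a with h | h
  · rw [coeffInt_of_neg _ (by omega), Finset.Ico_eq_empty (by omega), Finset.sum_empty]
  · rw [← Nat.cast_sub h, coeffInt_natCast, coeff_mul, Finset.sum_Ico_eq_sum_range,
      Finset.Nat.sum_antidiagonal_eq_sum_range_succ (fun i j => coeff i f * coeff j g),
      Nat.succ_eq_add_one, Nat.sub_add_comm h]
    refine Finset.sum_congr rfl fun c hc => ?_
    have hc' := Finset.mem_range.mp hc
    rw [show ((a + c : ℕ) : ℤ) - a = (c : ℕ) by omega,
      show (b : ℤ) - (a + c : ℕ) = ((b - a - c : ℕ) : ℤ) by omega,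
      coeffInt_natCast, coeffInt_natCast]

/-- The upper triangular Toeplitz matrix of the coefficients of a power series. -/
noncomputable def toeplitz (f : PowerSeries A) (N : ℕ) : Matrix (Fin N) (Fin N) A :=
  Matrix.of fun a c => coeffInt f ((c : ℤ) - (a : ℤ))

theorem toeplitz_mul (f g : PowerSeries A) (N : ℕ) :
    toeplitz f N * toeplitz g N = toeplitz (f * g) N := by
  ext a b
  simp only [toeplitz, Matrix.mul_apply, Matrix.of_apply]
  rw [Fin.sum_univ_eq_sum_range
    (fun c => coeffInt f ((c : ℤ) - (a : ℕ)) * coeffInt g (((b : ℕ) : ℤ) - c)) N]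
  exact sum_coeffInt_mul f g b.2

theorem toeplitz_one (N : ℕ) : toeplitz (1 : PowerSeries A) N = 1 := by
  ext a b
  simp only [toeplitz, Matrix.of_apply, Matrix.one_apply, coeffInt, coeff_one, Fin.ext_iff]
  split_ifs <;> first | rfl | omega

end PowerSeries

namespace Matrix

variable {A : Type*} [CommRing A]

theorem det_updateRow_updateRow_one {m : Type*} [Fintype m] [DecidableEq m] {a b : m}
    (hab : a ≠ b) (u v : m → A) :
    (((1 : Matrix m m A).updateRow a u).updateRow b v).det = u a * v b - u b * v a := by
  have h : ((1 : Matrix m m A).updateRow a u).updateRow b v =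
      1 + (of fun i s => (![Pi.single a 1, Pi.single b 1] s : m → A) i : Matrix m (Fin 2) A) *
        (of fun s i => ![u, v] s i - (![Pi.single a 1, Pi.single b 1] s : m → A) i :
          Matrix (Fin 2) m A) := by
    ext i c
    simp only [updateRow_apply, add_apply, one_apply, mul_apply, of_apply, Fin.sum_univ_two,
      cons_val_zero, cons_val_one, Pi.single_apply]
    by_cases hb : i = b
    · subst hb
      simp [hab.symm, eq_comm]
    · by_cases ha : i = a
      · subst ha
        simp [hb, eq_comm]
      · simp [ha, hb]
  rw [h, det_one_add_mul_comm, det_fin_two]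
  simp [mul_apply, hab, hab.symm, Pi.single_apply]

theorem det_updateRow_single {n : ℕ} (M : Matrix (Fin (n + 1)) (Fin (n + 1)) A)
    (i c : Fin (n + 1)) :
    (M.updateRow i (Pi.single c 1)).det =
      (-1) ^ (i + c : ℕ) * (M.submatrix i.succAbove c.succAbove).det := by
  rw [det_succ_row _ i, Finset.sum_eq_single c]
  · simp
  · intro b _ hb
    simp [hb]
  · simp

end Matrix

open PowerSeries in
/-- A minor of the Toeplitz matrix of `f`, expressed through a complementary `2 × 2` minor of the
Toeplitz matrix of `f⁻¹`. -/
theorem PowerSeries.det_coeffInt_two_columns {A : Type*} [CommRing A] {f g : PowerSeries A}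
    (hfg : f * g = 1) (hg : coeff 0 g = 1) {j l : ℕ} (hj : j ≤ l) :
    (Matrix.of fun i c : Fin l =>
        coeffInt f ((if (i : ℕ) < j then 2 else 1) - ((i : ℕ) : ℤ) + ((c : ℕ) : ℤ))).det =
      (-1) ^ (j + l) * (coeffInt g j * coeffInt g l -
        coeffInt g ((l : ℤ) + 1) * coeffInt g ((j : ℤ) - 1)) := by
  set a : Fin (l + 2) := (⟨j, by omega⟩ : Fin (l + 1)).castSucc with ha
  set b : Fin (l + 2) := Fin.last (l + 1) with hb
  set H := toeplitz f (l + 2)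
  set G := toeplitz g (l + 2)
  set P := (H.updateRow a (Pi.single 0 1)).updateRow b (Pi.single 1 1) with hP
  have hab : a ≠ b := by simp [ha, hb, Fin.ext_iff]; omega
  have hHG : H * G = 1 := by rw [toeplitz_mul, hfg, toeplitz_one]
  have hG : G.det = 1 := by
    have : G.IsUpperTriangular := fun r c hrc => by
      simp only [G, toeplitz, Matrix.of_apply]
      exact coeffInt_of_neg _ (by simp only [id, Fin.lt_def] at hrc; omega)
    rw [Matrix.det_of_isUpperTriangular this]
    refine Finset.prod_eq_one fun i _ => ?_
    simp only [G, toeplitz, Matrix.of_apply, sub_self]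
    rw [← Nat.cast_zero, coeffInt_natCast, hg]
  have h1 : (P * G).det = coeffInt g j * coeffInt g l -
        coeffInt g ((l : ℤ) + 1) * coeffInt g ((j : ℤ) - 1) := by
    rw [hP, Matrix.updateRow_mul, Matrix.updateRow_mul, hHG,
      Matrix.det_updateRow_updateRow_one hab]
    simp [G, toeplitz, ha, hb]
  have h2 : P.det = (-1) ^ (j + l) * (Matrix.of fun i c : Fin l =>
      coeffInt f ((if (i : ℕ) < j then 2 else 1) - ((i : ℕ) : ℤ) + ((c : ℕ) : ℤ))).det := by
    have hs : (H.updateRow a (Pi.single 0 1)).submatrix b.succAbove (Fin.succAbove 1) =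
        (H.submatrix b.succAbove (Fin.succAbove 1)).updateRow ⟨j, by omega⟩
          (Pi.single (0 : Fin (l + 1)) 1) := by
      ext r c
      simp only [Matrix.submatrix_apply, Matrix.updateRow_apply, ha, hb, Fin.succAbove_last,
        Fin.castSucc_inj]
      refine if_congr Iff.rfl ?_ rfl
      refine Fin.cases ?_ (fun c => ?_) c
      · simp
      · simp [Fin.ext_iff, Fin.succAbove, Fin.lt_def]
    rw [hP, Matrix.det_updateRow_single, hs, Matrix.det_updateRow_single]
    simp only [hb, Fin.val_last, Fin.val_one, Fin.val_zero, ← mul_assoc]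
    congr 1
    · ring
    · congr 1
      ext r c
      simp only [Matrix.submatrix_apply, H, toeplitz, Matrix.of_apply]
      congr 1
      simp only [Fin.succAbove, Fin.lt_def]
      split_ifs <;> simp_all <;> omega
  have h3 : P.det = (P * G).det := by rw [Matrix.det_mul, hG, mul_one]
  rw [← h1, ← h3, h2, ← mul_assoc, ← pow_add, Even.neg_one_pow ⟨_, rfl⟩, one_mul]

/-- The generating series `Σ hₙ tⁿ` of the complete homogeneous symmetric functions. -/
noncomputable def hSeries : PowerSeries (SymFn R) := PowerSeries.mk hSym

/-- The inverse `Σ (-1)ⁿ eₙ tⁿ` of the generating series of the complete homogeneous symmetric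
functions. -/
noncomputable def hSeriesInv : PowerSeries (SymFn R) := PowerSeries.invOfUnit hSeries 1

theorem hInt_zero : (hInt 0 : SymFn R) = 1 := by simp [hInt]

theorem hInt_of_neg {z : ℤ} (hz : z < 0) : (hInt z : SymFn R) = 0 := by
  rw [hInt, dif_neg (by omega), if_neg (by omega)]

theorem coeffInt_hSeries (z : ℤ) : PowerSeries.coeffInt (hSeries (R := R)) z = hInt z := by
  rcases lt_or_ge z 0 with h | h
  · rw [PowerSeries.coeffInt_of_neg _ h, hInt_of_neg h]
  · lift z to ℕ using h
    rw [PowerSeries.coeffInt_natCast, hSeries, PowerSeries.coeff_mk, hSym]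

theorem constantCoeff_hSeries : PowerSeries.constantCoeff (hSeries (R := R)) = 1 := by
  rw [← PowerSeries.coeff_zero_eq_constantCoeff_apply, hSeries, PowerSeries.coeff_mk, hSym,
    Nat.cast_zero, hInt_zero]

theorem hSeries_mul_hSeriesInv : hSeries (R := R) * hSeriesInv = 1 :=
  PowerSeries.mul_invOfUnit _ _ constantCoeff_hSeries

theorem coeff_zero_hSeriesInv : PowerSeries.coeff 0 (hSeriesInv (R := R)) = 1 := by
  simp [hSeriesInv]

theorem schurOf_two_columns_eq_coeffInt (j m : ℕ) :
    (schurOf (List.replicate j 2 ++ List.replicate m 1) : SymFn R) =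
      (-1) ^ (j + (j + m)) * (PowerSeries.coeffInt hSeriesInv j *
        PowerSeries.coeffInt hSeriesInv ((j + m : ℕ) : ℤ) -
        PowerSeries.coeffInt hSeriesInv (((j + m : ℕ) : ℤ) + 1) *
          PowerSeries.coeffInt hSeriesInv ((j : ℤ) - 1)) := by
  have hl : (List.replicate j 2 ++ List.replicate m 1).length = j + m := by simp
  rw [← hl, ← PowerSeries.det_coeffInt_two_columns hSeries_mul_hSeriesInv
    coeff_zero_hSeriesInv (by simp), schurOf, schurInt]
  congr 1
  ext1 i c
  simp only [Matrix.of_apply, coeffInt_hSeries, List.get_eq_getElem, List.getElem_append,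
    List.length_replicate, List.getElem_replicate]
  split_ifs <;> simp

theorem eSym_eq_coeff (n : ℕ) :
    (eSym n : SymFn R) = (-1) ^ n * PowerSeries.coeff n hSeriesInv := by
  have h := schurOf_two_columns_eq_coeffInt (R := R) 0 n
  rw [PowerSeries.coeffInt_of_neg _ (by simp : ((0 : ℕ) : ℤ) - 1 < 0), mul_zero, sub_zero,
    PowerSeries.coeffInt_natCast, PowerSeries.coeffInt_natCast, coeff_zero_hSeriesInv] at h
  simpa [eSym] using h

theorem eSym_zero : (eSym 0 : SymFn R) = 1 := by
  rw [eSym_eq_coeff, coeff_zero_hSeriesInv, pow_zero, one_mul]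

/-- The elementary symmetric function `e_a`, extended by `e_a = 0` for `a < 0`. -/
noncomputable def eInt (a : ℤ) : SymFn R := if 0 ≤ a then eSym a.toNat else 0

theorem eInt_natCast (n : ℕ) : (eInt n : SymFn R) = eSym n := by simp [eInt]

theorem eInt_of_neg {z : ℤ} (hz : z < 0) : (eInt z : SymFn R) = 0 := if_neg (not_le.mpr hz)

/-- The dual Jacobi–Trudi identity for partitions with at most two columns. -/
theorem schurOf_two_columns (j m : ℕ) :
    (schurOf (List.replicate j 2 ++ List.replicate m 1) : SymFn R) =
      eInt ((j + m : ℕ) : ℤ) * eInt j - eInt (((j + m : ℕ) : ℤ) + 1) * eInt ((j : ℤ) - 1) := by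
  rw [schurOf_two_columns_eq_coeffInt]
  rcases j with _ | j
  · rw [PowerSeries.coeffInt_of_neg _ (by simp : ((0 : ℕ) : ℤ) - 1 < 0),
      eInt_of_neg (by simp : ((0 : ℕ) : ℤ) - 1 < 0)]
    simp only [PowerSeries.coeffInt_natCast, eInt_natCast, eSym_eq_coeff]
    ring
  · rw [show ((j + 1 : ℕ) : ℤ) - 1 = (j : ℕ) by simp, ← Nat.cast_succ]
    simp only [PowerSeries.coeffInt_natCast, eInt_natCast, eSym_eq_coeff, Nat.succ_eq_add_one]
    ring

theorem map_hInt {S : Type*} [CommRing S] (φ : R →+* S) (z : ℤ) :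
    MvPolynomial.map φ (hInt z) = hInt z := by
  unfold hInt
  split_ifs <;> simp

theorem omegaSym_hInt (z : ℤ) : omegaSym (hInt z : SymFn R) = eInt z := by
  rcases lt_trichotomy z 0 with h | rfl | h
  · rw [hInt_of_neg h, eInt_of_neg h, map_zero]
  · simp [hInt_zero, eInt, eSym_zero]
  · rw [hInt, dif_pos h, omegaSym, aeval_X, eInt, if_pos h.le]

theorem tInv_X_pow (m : ℕ) : tInv (Polynomial.X ^ m) = LaurentPolynomial.T (-(m : ℤ)) := by
  simp [tInv]

theorem QpHL_singleton (n : ℕ) : QpHL [n] = hInt n := by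
  have : IsEmpty {p : Fin [n].length × Fin [n].length // p.1 < p.2} :=
    ⟨fun ⟨⟨a, b⟩, h⟩ => by simp only [List.length_singleton] at a b h; omega⟩
  rw [QpHL, finsum_unique]
  simp [schurInt]

theorem QpHL_pair (a b : ℕ) :
    QpHL [a, b] = ∑ m ∈ Finset.range (b + 1), C (Polynomial.X ^ m) *
      (hInt ((a : ℤ) + m) * hInt ((b : ℤ) - m) -
        hInt ((a : ℤ) + m + 1) * hInt ((b : ℤ) - m - 1)) := by
  let u : Unique {p : Fin [a, b].length × Fin [a, b].length // p.1 < p.2} :=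
    { default := ⟨((0 : Fin 2), (1 : Fin 2)), Fin.zero_lt_one⟩
      uniq := by
        rintro ⟨⟨i, j⟩, h⟩
        change Fin 2 at i j
        fin_cases i <;> fin_cases j <;> first | rfl | exact absurd h (lt_irrefl _) |
          exact absurd h (by simp) }
  rw [QpHL, ← finsum_comp_equiv (Equiv.funUnique _ ℕ).symm]
  have key (m : ℕ) : (C (Polynomial.X ^ (∑ p : {p : Fin [a, b].length × Fin [a, b].length // p.1 < p.2},
        (Equiv.funUnique _ ℕ).symm m p)) *
      schurInt (fun i : Fin [a, b].length =>
        ([a, b].get i : ℤ) + ∑ p : {p : Fin [a, b].length × Fin [a, b].length // p.1 < p.2},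
          (((Equiv.funUnique _ ℕ).symm m p : ℕ) : ℤ) *
            ((if p.1.1 = i then 1 else 0) - (if p.1.2 = i then 1 else 0))) :
      SymFn (Polynomial ℤ)) = C (Polynomial.X ^ m) *
      (hInt ((a : ℤ) + m) * hInt ((b : ℤ) - m) -
        hInt ((a : ℤ) + m + 1) * hInt ((b : ℤ) - m - 1)) := by
    have hd : (default : {p : Fin [a, b].length × Fin [a, b].length // p.1 < p.2}).1 =
      ((0 : Fin 2), (1 : Fin 2)) := rfl
    simp [schurInt, Matrix.det_fin_two, hd, sub_eq_add_neg]
  rw [finsum_congr key, finsum_eq_sum_of_support_subset]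
  intro m hm
  by_contra hmb
  simp only [Finset.coe_range, Set.mem_Iio, not_lt] at hmb
  refine hm ?_
  simp only
  rw [hInt_of_neg (by omega : (b : ℤ) - m < 0), hInt_of_neg (by omega : (b : ℤ) - m - 1 < 0)]
  simp

/-- For `n/2 < k ≤ n`, with `μ = (k^{n div k}, n mod k) = (k, n-k)`, the column
`k`-Schur function `s_{1^n}^{(k)}(X;t) = t^{n(μ)} ω(Q'_μ(X;1/t))` (here
`n(μ) = n - k`) expands in the Schur basis as
`Σ_{j=0}^{n-k} t^j s_{(2^j, 1^{n-2j})}`. -/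
theorem kSchur_column_expansion (n k : ℕ) (hk : 0 < k) (hkn : k ≤ n) (h2 : n / 2 < k) :
    (MvPolynomial.C (LaurentPolynomial.T ((n : ℤ) - (k : ℤ))) :
        SymFn (LaurentPolynomial ℤ)) *
      omegaSym (MvPolynomial.map tInv (QpHL (if k = n then [k] else [k, n - k]))) =
    ∑ j ∈ Finset.range (n - k + 1),
      MvPolynomial.C (LaurentPolynomial.T (j : ℤ)) *
        schurOf (List.replicate j 2 ++ List.replicate (n - 2 * j) 1) := by
  split_ifs with h
  · subst h
    simp [QpHL_singleton, map_hInt, omegaSym_hInt, eInt_natCast, eSym]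
  · rw [QpHL_pair, map_sum, map_sum, Finset.mul_sum, ← Finset.sum_range_reflect]
    refine Finset.sum_congr rfl fun j hj => ?_
    have hj' := Finset.mem_range.mp hj
    rw [schurOf_two_columns]
    simp only [map_mul, map_sub, map_hInt, omegaSym_hInt, map_C, tInv_X_pow]
    rw [← algebraMap_eq, AlgHom.commutes, algebraMap_eq, ← mul_assoc, ← C_mul,
      ← LaurentPolynomial.T_add]
    congr 3
    all_goals first | omega | exact congrArg eInt (by omega)
end
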